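/- Let s ∈ GL(3, 𝔽₃) be an element of odd order coprime to 3 (i.e., a semisimple 2'-element). If s ≠ 1, then s has order 13 and s is not conjugate to s⁻¹ in GL(3, 𝔽₃). -/

import Mathlib

/-- The Cayley–Hamilton theorem for `3 × 3` matrices, with explicit coefficients. -/
theorem Matrix.cayley_hamilton_fin_three {R : Type*} [CommRing R]
    (M : Matrix (Fin 3) (Fin 3) R) :
    M ^ 3 - M.trace • M ^ 2 + M.adjugate.trace • M - M.det • 1 = 0 := by
  ext i j
  fin_cases i <;> fin_cases j <;>
    simp [pow_succ, Matrix.mul_apply, Fin.sum_univ_three, Matrix.trace_fin_three,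
      Matrix.adjugate_fin_three, Matrix.det_fin_three] <;> ring

/-- If `a` is a root of `X ^ 3 - t X ^ 2 + t X - 1` over `𝔽₃`, then `a ^ 12 = 1`. -/
theorem pow_twelve_eq_one_of_selfReciprocal_cubic {A : Type*} [Ring A] [Algebra (ZMod 3) A]
    (a : A) (t : ZMod 3) (h : a ^ 3 - t • a ^ 2 + t • a - 1 = 0) : a ^ 12 = 1 := by
  have h3 : (3 : A) = 0 := by
    rw [← map_ofNat (algebraMap (ZMod 3) A) 3, show (OfNat.ofNat 3 : ZMod 3) = 0 from rfl,
      map_zero]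
  obtain rfl | rfl | rfl : t = 0 ∨ t = 1 ∨ t = 2 := by clear h; revert t; decide
  · have e : a ^ 3 = 1 := by simpa [sub_eq_zero] using h
    rw [show 12 = 3 * 4 from rfl, pow_mul, e, one_pow]
  · have e : a ^ 4 = 1 := by
      have e' : a ^ 4 - 1 = (a + 1) * (a ^ 3 - a ^ 2 + a - 1) := by noncomm_ring
      rw [one_smul, one_smul] at h
      rwa [h, mul_zero, sub_eq_zero] at e'
    rw [show 12 = 4 * 3 from rfl, pow_mul, e, one_pow]
  · have h' : a ^ 3 + a ^ 2 - a - 1 = 0 := by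
      simpa [show (2 : ZMod 3) = -1 from rfl, sub_eq_add_neg] using h
    have e : a ^ 6 = 1 := by
      have e' : a ^ 6 - 1 = (a ^ 3 - a ^ 2 - a + 1) * (a ^ 3 + a ^ 2 - a - 1)
          + 3 * (a ^ 4 - a ^ 2) := by noncomm_ring
      rwa [h', h3, mul_zero, zero_mul, add_zero, sub_eq_zero] at e'
    rw [show 12 = 6 * 2 from rfl, pow_mul, e, one_pow]

theorem card_GL_three_zmod_three : Nat.card (GL (Fin 3) (ZMod 3)) = 11232 := by
  have : Fact (Nat.Prime 3) := ⟨Nat.prime_three⟩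
  rw [Matrix.card_GL_field, Fin.prod_univ_three, ZMod.card]
  norm_num

/-- An element of `SL(3, 𝔽₃)` with the same trace as its inverse satisfies `s ^ 12 = 1`. -/
theorem pow_twelve_eq_one_of_trace_inv_eq (s : GL (Fin 3) (ZMod 3))
    (hdet : s.val.det = 1) (htr : s.val.trace = s⁻¹.val.trace) : s ^ 12 = 1 := by
  have hadj : s.val.adjugate.trace = s.val.trace := by
    rw [htr, Matrix.coe_units_inv, Matrix.inv_def, hdet, Ring.inverse_one, one_smul]
  have hCH := s.val.cayley_hamilton_fin_three
  rw [hadj, hdet, one_smul] at hCH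
  exact Units.ext (by simpa using pow_twelve_eq_one_of_selfReciprocal_cubic _ _ hCH)

theorem stmt_15 (s : GL (Fin 3) (ZMod 3)) (hs : Nat.Coprime (orderOf s) 6)
    (hs1 : s ≠ 1) : orderOf s = 13 ∧ ¬ IsConj s s⁻¹ := by
  have hdvd : orderOf s ∣ 6 ^ 5 * 13 :=
    (orderOf_dvd_natCard s).trans (by rw [card_GL_three_zmod_three]; decide)
  have h13 : orderOf s = 13 :=
    ((Nat.dvd_prime (by norm_num)).1 ((hs.pow_right 5).dvd_of_dvd_mul_left hdvd)).resolve_left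
      (mt orderOf_eq_one_iff.1 hs1)
  refine ⟨h13, fun hconj => ?_⟩
  obtain ⟨g, hg⟩ := isConj_iff.1 hconj
  have htr : s.val.trace = s⁻¹.val.trace := by
    rw [← hg, Units.val_mul, Units.val_mul, Matrix.trace_units_conj]
  have hdet : s.val.det = 1 := by
    have h : s.val.det ^ 13 = 1 := by
      rw [← Matrix.det_pow, ← Units.val_pow_eq_pow_val, ← h13, pow_orderOf_eq_one]
      simp
    generalize s.val.det = d at h
    revert d
    decide
  have := orderOf_dvd_of_pow_eq_one (pow_twelve_eq_one_of_trace_inv_eq s hdet htr)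
  rw [h13] at this
  norm_num at this
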